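/- Assume condition (C). Let Q be of form (Q2) and define W_Q(λ) = Q(λ+iπ)·Q(λ−η) + Q(λ)·Q(λ+iπ−η). Then the following are equivalent: (i) a(λ)·W_Q(λ) = d(λ)·W_Q(λ+η) for all λ ∈ ℂ; (ii) there exists ε ∈ {−1, +1} such that W_Q(λ) = d(λ)·w_ε(λ) for all λ ∈ ℂ. (Statement (i) is precisely the condition that the function t(λ) = [−a(λ)Q(λ−η) + d(λ)Q(λ+η)]/Q(λ) satisfies t(λ+iπ) = (−1)^{N−1} t(λ).) -/

import Mathlib

open Complex Finset

noncomputable section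

/-- Shifted inhomogeneity parameter `ξ_n^{(k)} = ξ_n + (s_n − k) η`, where `σ n = 2 s_n`. -/
def xik {N : ℕ} (η : ℂ) (σ : Fin N → ℕ) (ξ : Fin N → ℂ) (n : Fin N) (k : ℕ) : ℂ :=
  ξ n + ((σ n : ℂ) / 2 - (k : ℂ)) * η

/-- `a(λ) = ∏ₙ sinh (λ − ξ_n + s_n η)`. -/
def afun {N : ℕ} (η : ℂ) (σ : Fin N → ℕ) (ξ : Fin N → ℂ) (lam : ℂ) : ℂ :=
  ∏ n, Complex.sinh (lam - ξ n + ((σ n : ℂ) / 2) * η)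

/-- `d(λ) = ∏ₙ sinh (λ − ξ_n − s_n η)`. -/
def dfun {N : ℕ} (η : ℂ) (σ : Fin N → ℕ) (ξ : Fin N → ℂ) (lam : ℂ) : ℂ :=
  ∏ n, Complex.sinh (lam - ξ n - ((σ n : ℂ) / 2) * η)

/-- `t` is of t-form: `t(λ) = e^{−(N−1)λ} ∑_{j=0}^{N−1} c_j e^{2jλ}`. -/
def tForm (N : ℕ) (t : ℂ → ℂ) : Prop :=
  ∃ c : Fin N → ℂ, ∀ lam : ℂ,
    t lam = Complex.exp (-((N : ℂ) - 1) * lam) * ∑ j, c j * Complex.exp (2 * ((j : ℕ) : ℂ) * lam)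

/-- The `(2s_n+1) × (2s_n+1)` tridiagonal matrix `D_t^{(n)}`. -/
def Dmat {N : ℕ} (η : ℂ) (σ : Fin N → ℕ) (ξ : Fin N → ℂ) (t : ℂ → ℂ) (n : Fin N) :
    Matrix (Fin (σ n + 1)) (Fin (σ n + 1)) ℂ :=
  Matrix.of fun h k =>
    if (h : ℕ) = (k : ℕ) then t (xik η σ ξ n (h : ℕ))
    else if (k : ℕ) = (h : ℕ) + 1 then afun η σ ξ (xik η σ ξ n (h : ℕ))
    else if (h : ℕ) = (k : ℕ) + 1 then -(dfun η σ ξ (xik η σ ξ n (h : ℕ)))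
    else 0

/-- The set `Ξ_i = {ξ_i + kη + k′ iπ : k ∈ {−s_i, …, s_i}, k′ ∈ ℤ}`. -/
def XiSet {N : ℕ} (η : ℂ) (σ : Fin N → ℕ) (ξ : Fin N → ℂ) (i : Fin N) : Set ℂ :=
  {z : ℂ | ∃ k : ℕ, k ≤ σ i ∧ ∃ k' : ℤ, z = xik η σ ξ i k + (k' : ℂ) * ((Real.pi : ℂ) * Complex.I)}

/-- Condition (C): the sets `Ξ_i` are pairwise disjoint. -/
def CondC {N : ℕ} (η : ℂ) (σ : Fin N → ℕ) (ξ : Fin N → ℂ) : Prop :=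
  ∀ i j : Fin N, i ≠ j → XiSet η σ ξ i ∩ XiSet η σ ξ j = ∅

/-- The inhomogeneous term `F_x(λ)`. -/
def Ffun {N : ℕ} (η : ℂ) (σ : Fin N → ℕ) (ξ : Fin N → ℂ) (x lam : ℂ) : ℂ :=
  2 * Complex.exp (-(((∑ n, σ n : ℕ) : ℂ) + 1) * η / 2) *
    Complex.sinh (lam - x + (∑ j, ∑ h ∈ Finset.Icc 1 (σ j), xik η σ ξ j h)
      + (((∑ n, σ n : ℕ) : ℂ) + 1) * η / 2) *
    ∏ j, ∏ h ∈ Finset.range (σ j + 1), Complex.sinh (lam - xik η σ ξ j h)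

/-- `w_ε(λ) = 2 ε (i/2)^{N_s} ∏ₙ ∏_{h=1}^{2s_n−1} sinh(λ − ξ_n^{(h)})`. -/
def wfun {N : ℕ} (η : ℂ) (σ : Fin N → ℕ) (ξ : Fin N → ℂ) (ε lam : ℂ) : ℂ :=
  2 * ε * (Complex.I / 2) ^ (∑ n, σ n) *
    ∏ n, ∏ h ∈ Finset.Icc 1 (σ n - 1), Complex.sinh (lam - xik η σ ξ n h)

open Polynomial in
/-- The polynomial `∏ⱼ (t αⱼ X − αⱼ⁻¹)`, which is `∏ⱼ 2 sinh` in exponential variables. -/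
def sinhPoly {ι : Type*} [Fintype ι] (α : ι → ℂ) (t : ℂ) : ℂ[X] :=
  ∏ j, (C (t * α j) * X - C (α j)⁻¹)

section SinhPoly

variable {ι : Type*} [Fintype ι]

lemma sinhPoly_eval (α : ι → ℂ) (t q : ℂ) :
    (sinhPoly α t).eval q = ∏ j, (t * α j * q - (α j)⁻¹) := by
  simp [sinhPoly, Polynomial.eval_prod]

lemma sinhPoly_eval_neg (α : ι → ℂ) (t q : ℂ) :
    (sinhPoly α t).eval (-q) = (sinhPoly α (-t)).eval q := by
  simp [sinhPoly_eval]

lemma natDegree_linear_factor_le (a b : ℂ) :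
    (Polynomial.C a * Polynomial.X - Polynomial.C b).natDegree ≤ 1 := by
  compute_degree

lemma sinhPoly_natDegree_le (α : ι → ℂ) (t : ℂ) :
    (sinhPoly α t).natDegree ≤ Fintype.card ι := by
  refine (Polynomial.natDegree_prod_le _ _).trans ?_
  refine (Finset.sum_le_card_nsmul _ _ 1 fun j _ => natDegree_linear_factor_le _ _).trans ?_
  simp

lemma sinhPoly_coeff_card (α : ι → ℂ) (t : ℂ) :
    (sinhPoly α t).coeff (Fintype.card ι) = t ^ Fintype.card ι * ∏ j, α j := by
  have h := Polynomial.coeff_prod_of_natDegree_le Finset.univ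
    (fun j => Polynomial.C (t * α j) * Polynomial.X - Polynomial.C (α j)⁻¹) 1
    (fun j _ => natDegree_linear_factor_le _ _)
  rw [Finset.card_univ, mul_one] at h
  rw [sinhPoly, h]
  simp [Polynomial.coeff_C, Finset.prod_mul_distrib]

/-- A shifted product of hyperbolic sines as a polynomial in `exp lam`. -/
lemma prod_sinh_eq_sinhPoly (μ : ι → ℂ) (lam s : ℂ) :
    ∏ j, Complex.sinh ((lam + s - μ j) / 2) =
      (Complex.exp (-lam / 2) * Complex.exp (-s / 2) / 2) ^ Fintype.card ι *
        (sinhPoly (fun j => Complex.exp (-μ j / 2)) (Complex.exp s)).eval (Complex.exp lam) := by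
  rw [sinhPoly_eval, ← Finset.card_univ, ← Finset.prod_const, ← Finset.prod_mul_distrib]
  refine Finset.prod_congr rfl fun j _ => ?_
  rw [Complex.sinh, ← Complex.exp_neg, ← Complex.exp_add, ← Complex.exp_add, ← Complex.exp_add,
    div_mul_eq_mul_div, mul_sub, ← Complex.exp_add, ← Complex.exp_add]
  ring_nf

end SinhPoly

/-- An even polynomial of degree at most `2 card κ` vanishing at points with distinct squares is a
constant multiple of the product of the corresponding quadratic factors. -/
lemma eq_C_mul_prod_of_even_of_roots {κ : Type*} [Fintype κ] (D : Polynomial ℂ)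
    (hdeg : D.natDegree ≤ 2 * Fintype.card κ) (heven : ∀ q, D.eval (-q) = D.eval q)
    (r : κ → ℂ) (hr : ∀ k, r k ≠ 0) (hinj : Function.Injective fun k => r k ^ 2)
    (hroot : ∀ k, D.eval (r k) = 0) :
    D = Polynomial.C (D.coeff (2 * Fintype.card κ)) *
      ∏ k, (Polynomial.X ^ 2 - Polynomial.C (r k ^ 2)) := by
  have hmon (k : κ) : (Polynomial.X ^ 2 - Polynomial.C (r k ^ 2) : Polynomial ℂ).Monic :=
    Polynomial.monic_X_pow_sub_C _ two_ne_zero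
  have hmonic : (∏ k, (Polynomial.X ^ 2 - Polynomial.C (r k ^ 2) : Polynomial ℂ)).Monic :=
    Polynomial.monic_prod_of_monic _ _ fun k _ => hmon k
  have hnat : (∏ k, (Polynomial.X ^ 2 - Polynomial.C (r k ^ 2) : Polynomial ℂ)).natDegree
      = 2 * Fintype.card κ := by
    rw [Polynomial.natDegree_prod_of_monic _ _ fun k _ => hmon k]
    simp only [Polynomial.natDegree_X_pow_sub_C, Finset.sum_const, Finset.card_univ, smul_eq_mul,
      mul_comm]
  have hdvd : (∏ k, (Polynomial.X ^ 2 - Polynomial.C (r k ^ 2) : Polynomial ℂ)) ∣ D := by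
    refine Finset.prod_dvd_of_coprime (fun k _ l _ hkl => ?_) fun k _ => ?_
    · have hne : r l ^ 2 - r k ^ 2 ≠ 0 := sub_ne_zero.2 fun h => hkl (hinj h).symm
      refine ⟨Polynomial.C (r l ^ 2 - r k ^ 2)⁻¹, -Polynomial.C (r l ^ 2 - r k ^ 2)⁻¹, ?_⟩
      calc _ = Polynomial.C ((r l ^ 2 - r k ^ 2)⁻¹ * (r l ^ 2 - r k ^ 2)) := by
            simp only [Polynomial.C_mul, Polynomial.C_sub]; ring
        _ = 1 := by rw [inv_mul_cancel₀ hne, Polynomial.C_1]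
    · have hfac : (Polynomial.X ^ 2 - Polynomial.C (r k ^ 2) : Polynomial ℂ) =
          (Polynomial.X - Polynomial.C (r k)) * (Polynomial.X - Polynomial.C (-r k)) := by
        simp only [Polynomial.C_pow, Polynomial.C_neg]; ring
      rw [hfac]
      refine IsCoprime.mul_dvd (Polynomial.isCoprime_X_sub_C_of_isUnit_sub ?_)
        (Polynomial.dvd_iff_isRoot.2 (hroot k))
        (Polynomial.dvd_iff_isRoot.2 ((heven _).trans (hroot k)))
      rw [isUnit_iff_ne_zero, sub_neg_eq_add, ← two_mul]
      exact mul_ne_zero two_ne_zero (hr k)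
  have h := Polynomial.eq_leadingCoeff_mul_of_monic_of_dvd_of_natDegree_le hmonic hdvd
    (hdeg.trans hnat.ge)
  have hcoeff := congrArg (fun p => p.coeff (2 * Fintype.card κ)) h
  simp only [Polynomial.coeff_C_mul] at hcoeff
  rw [← hnat, hmonic.coeff_natDegree, mul_one, hnat] at hcoeff
  rw [hcoeff]
  exact h

lemma exp_two_mul_sub_one (z : ℂ) :
    Complex.exp z ^ 2 - 1 = 2 * Complex.exp z * Complex.sinh z := by
  rw [Complex.sinh, Complex.exp_neg]
  field_simp [Complex.exp_ne_zero]

/-- If the quantum Wronskian vanishes at as many points, distinct modulo `iπ`, as its degree,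
then it is determined by these zeros up to a sign. -/
lemma wronskian_eq_of_zeros {ι κ : Type*} [Fintype ι] [Fintype κ]
    (hcard : Fintype.card κ = Fintype.card ι) (η : ℂ) (μ : ι → ℂ) (x : κ → ℂ)
    (Q W : ℂ → ℂ)
    (hQ : ∀ lam : ℂ, Q lam = ∏ j, Complex.sinh ((lam - μ j) / 2))
    (hW : ∀ lam : ℂ, W lam =
      Q (lam + (Real.pi : ℂ) * Complex.I) * Q (lam - η)
        + Q lam * Q (lam + (Real.pi : ℂ) * Complex.I - η))
    (hinj : Function.Injective fun k => Complex.exp (x k) ^ 2)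
    (hzero : ∀ k, W (x k) = 0) :
    ∃ ε : ℂ, (ε = 1 ∨ ε = -1) ∧ ∀ lam : ℂ,
      W lam = 2 * ε * (Complex.I / 2) ^ Fintype.card ι * ∏ k, Complex.sinh (lam - x k) := by
  set M := Fintype.card ι with hM
  set α : ι → ℂ := fun j => Complex.exp (-μ j / 2) with hα
  set c := Complex.exp (-η) with hc
  set b := Complex.exp (-η / 2) with hb
  have hb0 : b ≠ 0 := Complex.exp_ne_zero _
  have hbc : b ^ 2 = c := by rw [hb, hc, ← Complex.exp_nat_mul]; congr 1; push_cast; ring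
  set D := sinhPoly α (-1) * sinhPoly α c + sinhPoly α 1 * sinhPoly α (-c) with hD
  have hpi : Complex.exp (-((Real.pi : ℂ) * Complex.I) / 2) = -Complex.I := by
    rw [show -((Real.pi : ℂ) * Complex.I) / 2 = -((Real.pi : ℂ) / 2 * Complex.I) by ring,
      Complex.exp_neg, Complex.exp_pi_div_two_mul_I, Complex.inv_I]
  have hWD (lam : ℂ) : W lam = ((Complex.exp lam)⁻¹ / 4 * -Complex.I / b) ^ M *
      D.eval (Complex.exp lam) := by
    have hQs (s : ℂ) : Q (lam + s) = (Complex.exp (-lam / 2) * Complex.exp (-s / 2) / 2) ^ M *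
        (sinhPoly α (Complex.exp s)).eval (Complex.exp lam) := by
      rw [hQ, prod_sinh_eq_sinhPoly]
    have h0 := hQs 0
    have h1 := hQs (Real.pi * Complex.I)
    have h2 := hQs (-η)
    have h3 := hQs (Real.pi * Complex.I + -η)
    have hb' : Complex.exp (- -η / 2) = b⁻¹ := by
      rw [hb, ← Complex.exp_neg]; congr 1; ring
    have hbI : Complex.exp (-(Real.pi * Complex.I + -η) / 2) = -Complex.I * b⁻¹ := by
      rw [← hpi, ← hb', ← Complex.exp_add]; congr 1; ring
    rw [add_zero, neg_zero, zero_div, Complex.exp_zero, mul_one] at h0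
    rw [hpi, Complex.exp_pi_mul_I] at h1
    rw [hb', ← sub_eq_add_neg] at h2
    rw [hbI, Complex.exp_add, Complex.exp_pi_mul_I, ← add_assoc, ← sub_eq_add_neg, neg_one_mul] at h3
    have hsq : (Complex.exp lam)⁻¹ = Complex.exp (-lam / 2) * Complex.exp (-lam / 2) := by
      rw [← Complex.exp_neg, ← Complex.exp_add]; congr 1; ring
    have hprod (u v : ℂ) (p q : ℂ) (huv : u * v = (Complex.exp lam)⁻¹ / 4 * -Complex.I / b) :
        u ^ M * p * (v ^ M * q) = ((Complex.exp lam)⁻¹ / 4 * -Complex.I / b) ^ M * (p * q) := by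
      rw [mul_mul_mul_comm, ← mul_pow, huv]
    rw [hW, h0, h1, h2, h3, hD, Polynomial.eval_add, Polynomial.eval_mul, Polynomial.eval_mul,
      mul_add, hprod _ _ _ _ (by rw [hsq]; ring), hprod _ _ _ _ (by rw [hsq]; ring)]
  have heven (q : ℂ) : D.eval (-q) = D.eval q := by
    simp only [hD, Polynomial.eval_add, Polynomial.eval_mul, sinhPoly_eval_neg, neg_neg]
    ring
  have hdeg2 (s t : ℂ) : (sinhPoly α s * sinhPoly α t).natDegree ≤ 2 * M :=
    (Polynomial.natDegree_mul_le_of_le (sinhPoly_natDegree_le α s)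
      (sinhPoly_natDegree_le α t)).trans (two_mul M).ge
  have hroot (k : κ) : D.eval (Complex.exp (x k)) = 0 := by
    have h := hzero k
    rw [hWD] at h
    refine (mul_eq_zero.1 h).resolve_left (pow_ne_zero _ ?_)
    simp [Complex.exp_ne_zero, hb0]
  have hDeq := eq_C_mul_prod_of_even_of_roots D
    (by rw [hcard]; exact Polynomial.natDegree_add_le_of_degree_le (hdeg2 _ _) (hdeg2 _ _))
    heven (fun k => Complex.exp (x k)) (fun k => Complex.exp_ne_zero _) hinj hroot
  set A := ∏ j, α j with hA
  have hA0 : A ≠ 0 := Finset.prod_ne_zero_iff.2 fun j _ => Complex.exp_ne_zero _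
  set Y := ∏ k, Complex.exp (x k) with hY
  have hcoeff : D.coeff (2 * Fintype.card κ) = 2 * (-1) ^ M * (b ^ M) ^ 2 * A ^ 2 := by
    have h (s t : ℂ) : (sinhPoly α s * sinhPoly α t).coeff (2 * M) = s ^ M * A * (t ^ M * A) := by
      rw [two_mul, Polynomial.coeff_mul_add_eq_of_natDegree_le (sinhPoly_natDegree_le α s)
        (sinhPoly_natDegree_le α t), sinhPoly_coeff_card, sinhPoly_coeff_card]
    rw [hcard, hD, Polynomial.coeff_add, h, h, ← hbc, neg_pow (b ^ 2)]
    ring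
  rw [hcoeff] at hDeq
  have hεsq : (b ^ M * A ^ 2 * Y) ^ 2 = 1 := by
    have h := congrArg (Polynomial.eval 0) hDeq
    simp only [hD, Polynomial.eval_add, Polynomial.eval_mul, sinhPoly_eval, mul_zero, zero_sub,
      Polynomial.eval_prod, Polynomial.eval_sub, Polynomial.eval_pow, Polynomial.eval_X,
      Polynomial.eval_C, ne_eq, OfNat.ofNat_ne_zero, not_false_eq_true, zero_pow,
      Finset.prod_neg, Finset.prod_inv_distrib, Finset.prod_pow, Finset.card_univ, hcard, ← hM,
      ← hA, ← hY] at h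
    have hs : ((-1 : ℂ) ^ M) * (-1) ^ M = 1 := by rw [← mul_pow]; simp
    have h2 : (A⁻¹) ^ 2 = (b ^ M) ^ 2 * A ^ 2 * Y ^ 2 := by
      linear_combination h / 2 + ((b ^ M) ^ 2 * A ^ 2 * Y ^ 2 - A⁻¹ ^ 2) * hs
    calc _ = ((b ^ M) ^ 2 * A ^ 2 * Y ^ 2) * A ^ 2 := by ring
      _ = 1 := by rw [← h2, ← mul_pow, inv_mul_cancel₀ hA0, one_pow]
  refine ⟨b ^ M * A ^ 2 * Y, by simpa using hεsq, fun lam => ?_⟩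
  have hfac (k : κ) : Complex.exp lam ^ 2 - Complex.exp (x k) ^ 2 =
      2 * Complex.exp lam * Complex.exp (x k) * Complex.sinh (lam - x k) := by
    rw [Complex.sinh, neg_sub, Complex.exp_sub, Complex.exp_sub]
    field_simp [Complex.exp_ne_zero]
  rw [hWD, hDeq]
  simp only [Polynomial.eval_mul, Polynomial.eval_C, Polynomial.eval_prod, Polynomial.eval_sub,
    Polynomial.eval_pow, Polynomial.eval_X, hfac, Finset.prod_mul_distrib, Finset.prod_const,
    Finset.card_univ, hcard, ← hY]
  have hcollect : ((Complex.exp lam)⁻¹ / 4 * -Complex.I / b) ^ M * (-1) ^ M * b ^ M * 2 ^ M *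
      Complex.exp lam ^ M = (Complex.I / 2) ^ M := by
    rw [← mul_pow, ← mul_pow, ← mul_pow, ← mul_pow]
    congr 1
    field_simp [Complex.exp_ne_zero]
    norm_num
  rw [← hcollect]
  ring

section Zeros

variable {N : ℕ} {η : ℂ} {σ : Fin N → ℕ} {ξ : Fin N → ℂ}

lemma afun_eq_prod_sinh (lam : ℂ) :
    afun η σ ξ lam = ∏ n, Complex.sinh (lam - xik η σ ξ n (σ n)) := by
  refine Finset.prod_congr rfl fun n _ => ?_
  rw [xik]; congr 1; ring

lemma dfun_eq_prod_sinh (lam : ℂ) :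
    dfun η σ ξ lam = ∏ n, Complex.sinh (lam - xik η σ ξ n 0) := by
  refine Finset.prod_congr rfl fun n _ => ?_
  rw [xik]; congr 1; push_cast; ring

lemma xik_succ (n : Fin N) (k : ℕ) : xik η σ ξ n (k + 1) + η = xik η σ ξ n k := by
  rw [xik, xik]; push_cast; ring

/-- The points `ξ_n^{(k)}` are distinct modulo `iπ`. -/
lemma xik_inj_mod_pi (hη : ∀ r : ℚ, η ≠ (r : ℂ) * ((Real.pi : ℂ) * Complex.I))
    (hC : CondC η σ ξ) {n m : Fin N} {k l : ℕ} (hk : k ≤ σ n) (hl : l ≤ σ m) {z : ℤ}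
    (h : xik η σ ξ n k = xik η σ ξ m l + (z : ℂ) * ((Real.pi : ℂ) * Complex.I)) :
    n = m ∧ k = l := by
  by_cases hnm : n = m
  · subst hnm
    refine ⟨rfl, ?_⟩
    by_contra hkl
    have hne : (l : ℂ) - k ≠ 0 := sub_ne_zero.2 fun e => hkl (Nat.cast_injective e).symm
    refine hη ((z : ℚ) / ((l : ℚ) - k)) ?_
    push_cast
    rw [div_mul_eq_mul_div, eq_div_iff hne]
    simp only [xik] at h
    linear_combination h
  · have hmem : xik η σ ξ n k ∈ XiSet η σ ξ n ∩ XiSet η σ ξ m :=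
      ⟨⟨k, hk, 0, by simp⟩, ⟨l, hl, z, h⟩⟩
    rw [hC n m hnm] at hmem
    exact hmem.elim

lemma sinh_eq_zero_imp_int_mul {z : ℂ} (h : Complex.sinh z = 0) :
    ∃ k : ℤ, z = k * ((Real.pi : ℂ) * Complex.I) := by
  have h1 : Complex.exp z ^ 2 = 1 := by
    rw [← sub_eq_zero, exp_two_mul_sub_one, h, mul_zero]
  rw [← Complex.exp_nat_mul, Complex.exp_eq_one_iff] at h1
  obtain ⟨k, hk⟩ := h1
  refine ⟨k, ?_⟩
  push_cast at hk
  linear_combination hk / 2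

lemma exp_sq_xik_injective (hη : ∀ r : ℚ, η ≠ (r : ℂ) * ((Real.pi : ℂ) * Complex.I))
    (hC : CondC η σ ξ) :
    Function.Injective fun p : (n : Fin N) × Fin (σ n) =>
      Complex.exp (xik η σ ξ p.1 p.2) ^ 2 := by
  rintro ⟨n, k⟩ ⟨m, l⟩ h
  simp only [← Complex.exp_nat_mul, Complex.exp_eq_exp_iff_exists_int] at h
  obtain ⟨z, hz⟩ := h
  push_cast at hz
  obtain ⟨rfl, hkl⟩ := xik_inj_mod_pi hη hC k.2.le l.2.le (z := z) (by linear_combination hz / 2)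
  rw [Fin.ext hkl]

lemma afun_xik_ne_zero (hη : ∀ r : ℚ, η ≠ (r : ℂ) * ((Real.pi : ℂ) * Complex.I))
    (hC : CondC η σ ξ) {n : Fin N} {k : ℕ} (hk : k < σ n) :
    afun η σ ξ (xik η σ ξ n k) ≠ 0 := by
  rw [afun_eq_prod_sinh, Finset.prod_ne_zero_iff]
  intro m _ h
  obtain ⟨z, hz⟩ := sinh_eq_zero_imp_int_mul h
  obtain ⟨rfl, hkl⟩ := xik_inj_mod_pi hη hC hk.le le_rfl (z := z) (by linear_combination hz)
  exact hk.ne hkl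

lemma dfun_xik_zero (n : Fin N) : dfun η σ ξ (xik η σ ξ n 0) = 0 := by
  rw [dfun_eq_prod_sinh]
  exact Finset.prod_eq_zero (Finset.mem_univ n) (by simp)

lemma dfun_mul_wfun (hσ : ∀ n, 1 ≤ σ n) (ε lam : ℂ) :
    dfun η σ ξ lam * wfun η σ ξ ε lam = 2 * ε * (Complex.I / 2) ^ (∑ n, σ n) *
      ∏ n, ∏ h ∈ Finset.range (σ n), Complex.sinh (lam - xik η σ ξ n h) := by
  rw [dfun_eq_prod_sinh, wfun, mul_left_comm, ← Finset.prod_mul_distrib]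
  congr 1
  refine Finset.prod_congr rfl fun n _ => ?_
  obtain ⟨s, hs⟩ := Nat.exists_eq_add_of_le' (hσ n)
  rw [hs, Finset.prod_range_succ', mul_comm, Nat.add_sub_cancel]
  congr 1
  rw [Finset.range_eq_Ico, Finset.prod_Ico_add' (fun h => Complex.sinh (lam - xik η σ ξ n h)) 0 s 1]
  rfl

lemma afun_mul_dfun_mul_wfun (hσ : ∀ n, 1 ≤ σ n) (ε lam : ℂ) :
    afun η σ ξ lam * (dfun η σ ξ lam * wfun η σ ξ ε lam) =
      dfun η σ ξ lam * (dfun η σ ξ (lam + η) * wfun η σ ξ ε (lam + η)) := by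
  rw [dfun_mul_wfun hσ, dfun_mul_wfun hσ, afun_eq_prod_sinh, dfun_eq_prod_sinh, mul_left_comm,
    mul_left_comm (∏ n, _), ← Finset.prod_mul_distrib, ← Finset.prod_mul_distrib]
  congr 1
  refine Finset.prod_congr rfl fun n _ => ?_
  have hshift (h : ℕ) : lam + η - xik η σ ξ n h = lam - xik η σ ξ n (h + 1) := by
    rw [← xik_succ n h]; ring
  simp only [hshift]
  rw [mul_comm, ← Finset.prod_range_succ (fun h => Complex.sinh (lam - xik η σ ξ n h)),
    Finset.prod_range_succ' (fun h => Complex.sinh (lam - xik η σ ξ n h)), mul_comm]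

/-- The functional equation forces `W` to vanish at `ξ_n^{(k)}` for `k < 2 s_n`. -/
lemma eq_zero_at_xik_of_functional_eq
    (hη : ∀ r : ℚ, η ≠ (r : ℂ) * ((Real.pi : ℂ) * Complex.I)) (hC : CondC η σ ξ) {W : ℂ → ℂ}
    (hfun : ∀ lam : ℂ, afun η σ ξ lam * W lam = dfun η σ ξ lam * W (lam + η))
    (n : Fin N) (k : ℕ) (hk : k < σ n) : W (xik η σ ξ n k) = 0 := by
  refine (mul_eq_zero.1 ((hfun _).trans ?_)).resolve_left (afun_xik_ne_zero hη hC hk)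
  induction k with
  | zero => rw [dfun_xik_zero, zero_mul]
  | succ k ih =>
    have hk' : k < σ n := Nat.lt_of_succ_lt hk
    rw [xik_succ, (mul_eq_zero.1 ((hfun _).trans (ih hk'))).resolve_left
      (afun_xik_ne_zero hη hC hk'), mul_zero]

end Zeros

theorem stmt_7 {N : ℕ} (hN : 1 ≤ N) (σ : Fin N → ℕ) (hσ : ∀ n, 1 ≤ σ n)
    (η : ℂ) (hη : ∀ r : ℚ, η ≠ (r : ℂ) * ((Real.pi : ℂ) * Complex.I))
    (ξ : Fin N → ℂ) (hC : CondC η σ ξ)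
    (Q : ℂ → ℂ) (μ : Fin (∑ n, σ n) → ℂ)
    (hQ : ∀ lam : ℂ, Q lam = ∏ j, Complex.sinh ((lam - μ j) / 2))
    (W : ℂ → ℂ)
    (hW : ∀ lam : ℂ, W lam =
      Q (lam + (Real.pi : ℂ) * Complex.I) * Q (lam - η)
        + Q lam * Q (lam + (Real.pi : ℂ) * Complex.I - η)) :
    (∀ lam : ℂ, afun η σ ξ lam * W lam = dfun η σ ξ lam * W (lam + η)) ↔
      (∃ ε : ℂ, (ε = 1 ∨ ε = -1) ∧
        ∀ lam : ℂ, W lam = dfun η σ ξ lam * wfun η σ ξ ε lam) := by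
  constructor
  · intro hfun
    obtain ⟨ε, hε, h⟩ := wronskian_eq_of_zeros
      (κ := (n : Fin N) × Fin (σ n)) (by simp) η μ (fun p => xik η σ ξ p.1 p.2) Q W hQ hW
      (exp_sq_xik_injective hη hC)
      fun p => eq_zero_at_xik_of_functional_eq hη hC hfun p.1 p.2 p.2.2
    refine ⟨ε, hε, fun lam => ?_⟩
    rw [h, dfun_mul_wfun hσ, Fintype.card_fin, Fintype.prod_sigma]
    simp only [Finset.prod_range]
  · rintro ⟨ε, -, h⟩ lam
    rw [h, h, afun_mul_dfun_mul_wfun hσ]
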